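/- Let n ≥ 1 and 0 ≤ m ≤ n be integers, and let f ∈ ℂ[x₁, …, x_n] be antisymmetric, i.e. f(x_{σ(1)}, …, x_{σ(n)}) = sign(σ)·f(x₁, …, x_n) for every permutation σ of {1, …, n}. Then the Vandermonde product Δ = ∏_{1≤i<j≤n} (x_i − x_j) divides f, and writing g = f/Δ for the polynomial quotient, for every x ∈ ℂ one has: (∂/∂x₁)⋯(∂/∂x_m) g evaluated at x₁ = ⋯ = x_n = x equals Σ_{λ ∈ Y_m} ( f_λ / ∏_{i=1}^n (λ_i + n − i)! ) · ∏_{i=1}^n (∂^{λ_i+n−i}/∂x_i^{λ_i+n−i}) f evaluated at x₁ = ⋯ = x_n = x, where each partition λ of m is padded with zeros to have exactly n parts λ₁ ≥ … ≥ λ_n ≥ 0 (this is possible since m ≤ n). -/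

import Mathlib

namespace AntisymDeriv

/-- Partitions of weight `m`, padded with zeros to have exactly `n` parts, encoded as
antitone functions `Fin n → Fin (m+1)` whose values sum to `m`. -/
noncomputable def YsPad (n m : ℕ) : Finset (Fin n → Fin (m + 1)) :=
  Finset.univ.filter fun l =>
    (∀ i j : Fin n, i ≤ j → (l j : ℕ) ≤ (l i : ℕ)) ∧ (∑ i, (l i : ℕ)) = m

/-- The number of standard Young tableaux of shape `l`: bijective fillings of the diagram of
`l` by `1, …, |l|`, strictly increasing to the right along rows and downwards along columns. -/
noncomputable def sytCard {n : ℕ} (l : Fin n → ℕ) : ℕ :=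
  Nat.card {T : (Σ i : Fin n, Fin (l i)) → Fin (∑ i, l i) //
    Function.Bijective T ∧
    (∀ i : Fin n, StrictMono fun j : Fin (l i) => T ⟨i, j⟩) ∧
    (∀ (i i' : Fin n) (j : Fin (l i)) (j' : Fin (l i')),
      i < i' → (j : ℕ) = (j' : ℕ) → T ⟨i, j⟩ < T ⟨i', j'⟩)}

/-- Iterated formal partial derivatives: apply `(∂/∂x_i)^{e i}` for each variable `i`. -/
noncomputable def pderivs {n : ℕ} (e : Fin n → ℕ) (p : MvPolynomial (Fin n) ℂ) :
    MvPolynomial (Fin n) ℂ :=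
  (List.finRange n).foldl (fun q i => (fun r => MvPolynomial.pderiv i r)^[e i] q) p

/-- The Vandermonde product `Δ = ∏_{i<j} (x_i - x_j)`. -/
noncomputable def vandermonde (n : ℕ) : MvPolynomial (Fin n) ℂ :=
  ∏ p ∈ Finset.univ.filter (fun p : Fin n × Fin n => p.1 < p.2),
    (MvPolynomial.X p.1 - MvPolynomial.X p.2)

open MvPolynomial Finset

/-! ### Divisibility by the Vandermonde product -/

theorem irreducible_X_sub_X {n : ℕ} {i j : Fin n} (h : i ≠ j) :
    Irreducible (X i - X j : MvPolynomial (Fin n) ℂ) := by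
  have key : (X i - X j : MvPolynomial (Fin n) ℂ) =
      sumSMulX (Finsupp.single i (1 : ℂ) - Finsupp.single j 1) := by
    simp [sumSMulX]
  have hi : (Finsupp.single i (1 : ℂ) - Finsupp.single j 1 : Fin n →₀ ℂ) i = 1 := by
    simp [h]
  rw [key]
  refine irreducible_sumSMulX _ ⟨i, ?_⟩ fun r hr => isUnit_of_dvd_one (hi ▸ hr i)
  simp [hi]

theorem X_sub_X_not_dvd {n : ℕ} {p q : Fin n × Fin n} (hp : p.1 < p.2) (hq : q.1 < q.2)
    (h : p ≠ q) : ¬ (X p.1 - X p.2 : MvPolynomial (Fin n) ℂ) ∣ X q.1 - X q.2 := by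
  have aux : ∀ v : Fin n → ℂ, v p.1 = v p.2 → v q.1 ≠ v q.2 →
      ¬ (X p.1 - X p.2 : MvPolynomial (Fin n) ℂ) ∣ X q.1 - X q.2 := by
    rintro v h1 h2 ⟨r, hr⟩
    have := congrArg (eval v) hr
    simp [h1, sub_eq_zero, h2] at this
  obtain ⟨a, b⟩ := p
  obtain ⟨c, d⟩ := q
  simp only [ne_eq, Prod.mk.injEq, not_and] at *
  by_cases hc : c = a ∨ c = b
  · refine aux (Pi.single d 1) ?_ ?_
    · rw [Pi.single_eq_of_ne, Pi.single_eq_of_ne] <;> grind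
    · rw [Pi.single_eq_of_ne hq.ne]; simp
  · refine aux (Pi.single c 1) ?_ ?_
    · rw [Pi.single_eq_of_ne, Pi.single_eq_of_ne] <;> grind
    · rw [Pi.single_eq_of_ne hq.ne']; simp

theorem X_sub_X_dvd_sub_rename_swap {n : ℕ} (i j : Fin n) (f : MvPolynomial (Fin n) ℂ) :
    (X i - X j : MvPolynomial (Fin n) ℂ) ∣ f - rename (Equiv.swap i j) f := by
  rw [← Ideal.mem_span_singleton, ← Ideal.Quotient.eq]
  have hij : Ideal.Quotient.mkₐ ℂ (Ideal.span {(X i - X j : MvPolynomial (Fin n) ℂ)}) (X i) =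
      Ideal.Quotient.mkₐ ℂ (Ideal.span {(X i - X j : MvPolynomial (Fin n) ℂ)}) (X j) :=
    Ideal.Quotient.eq.2 (Ideal.mem_span_singleton_self _)
  have key : Ideal.Quotient.mkₐ ℂ (Ideal.span {(X i - X j : MvPolynomial (Fin n) ℂ)}) =
      (Ideal.Quotient.mkₐ ℂ (Ideal.span {(X i - X j : MvPolynomial (Fin n) ℂ)})).comp
        (rename (Equiv.swap i j)) := by
    refine MvPolynomial.algHom_ext fun k => ?_
    rw [AlgHom.comp_apply, rename_X]
    rcases eq_or_ne k i with rfl | hi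
    · rw [Equiv.swap_apply_left, hij]
    rcases eq_or_ne k j with rfl | hj
    · rw [Equiv.swap_apply_right, hij]
    rw [Equiv.swap_apply_of_ne_of_ne hi hj]
  exact DFunLike.congr_fun key f

theorem vandermonde_dvd {n : ℕ} {f : MvPolynomial (Fin n) ℂ}
    (hf : ∀ σ : Equiv.Perm (Fin n), rename σ f = (Equiv.Perm.sign σ : ℤ) • f) :
    vandermonde n ∣ f := by
  refine Finset.prod_dvd_of_isRelPrime ?_ ?_
  · intro p hp q hq hpq
    simp only [coe_filter, mem_univ, true_and, Set.mem_ofPred_eq] at hp hq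
    exact (irreducible_X_sub_X hp.ne).isRelPrime_iff_not_dvd.2 (X_sub_X_not_dvd hp hq hpq)
  · intro p hp
    have hp' : p.1 < p.2 := (mem_filter.1 hp).2
    have h := X_sub_X_dvd_sub_rename_swap p.1 p.2 f
    rw [hf, Equiv.Perm.sign_swap hp'.ne] at h
    have h2 : f - ((-1 : ℤˣ) : ℤ) • f = C 2 * f := by
      rw [map_ofNat]; simp; ring
    rw [h2] at h
    exact (IsUnit.dvd_mul_left ((isUnit_iff_ne_zero.2 two_ne_zero).map C)).1 h

/-! ### Iterated derivatives on the diagonal as coefficients -/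

/-- The coefficient of the monomial `∏ i, x_i ^ e i`. -/
noncomputable def exponentCoeff {n : ℕ} (p : MvPolynomial (Fin n) ℂ) (e : Fin n → ℕ) : ℂ :=
  coeff (Finsupp.equivFunOnFinite.symm e) p

/-- The substitution `x_i ↦ x_i + x` for every `i`. -/
noncomputable def translate {n : ℕ} (x : ℂ) :
    MvPolynomial (Fin n) ℂ →ₐ[ℂ] MvPolynomial (Fin n) ℂ :=
  aeval fun i => X i + C x

theorem translate_X {n : ℕ} (x : ℂ) (i : Fin n) : translate x (X i) = X i + C x := by
  simp [translate]

theorem translate_pderiv {n : ℕ} (x : ℂ) (i : Fin n) (p : MvPolynomial (Fin n) ℂ) :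
    translate x (pderiv i p) = pderiv i (translate x p) := by
  induction p using MvPolynomial.induction_on with
  | C a => simp [translate, algebraMap_eq]
  | add p q hp hq => simp [hp, hq]
  | mul_X p j hp =>
    simp only [Derivation.leibniz, smul_eq_mul, map_add, map_mul, hp, translate_X, pderiv_C,
      add_zero, pderiv_X]
    rcases eq_or_ne j i with rfl | h <;> simp [*]

theorem rename_translate {n : ℕ} (x : ℂ) (σ : Fin n → Fin n) (p : MvPolynomial (Fin n) ℂ) :
    rename σ (translate x p) = translate x (rename σ p) := by
  have : (rename σ).comp (translate x) = (translate x).comp (rename σ) :=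
    MvPolynomial.algHom_ext fun i => by simp [translate_X]
  exact DFunLike.congr_fun this p

theorem translate_vandermonde (n : ℕ) (x : ℂ) :
    translate x (vandermonde n) = vandermonde n := by
  simp [vandermonde, map_prod, translate_X]

theorem eval_const_eq_coeff_translate {n : ℕ} (x : ℂ) (p : MvPolynomial (Fin n) ℂ) :
    eval (fun _ => x) p = coeff 0 (translate x p) := by
  rw [← constantCoeff_eq]
  have : (eval fun _ : Fin n => x) =
      (constantCoeff : MvPolynomial (Fin n) ℂ →+* ℂ).comp (translate x).toRingHom :=
    MvPolynomial.ringHom_ext (fun a => by simp [translate, algebraMap_eq])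
      (fun i => by simp [translate_X])
  exact DFunLike.congr_fun this p

theorem translate_pderivs {n : ℕ} (x : ℂ) (e : Fin n → ℕ) (p : MvPolynomial (Fin n) ℂ) :
    translate x (pderivs e p) = pderivs e (translate x p) := by
  unfold pderivs
  induction List.finRange n generalizing p with
  | nil => rfl
  | cons i l ih =>
    rw [List.foldl_cons, List.foldl_cons, ih]
    congr 1
    induction e i generalizing p with
    | zero => rfl
    | succ k ihk => rw [Function.iterate_succ_apply, ihk, translate_pderiv,
        Function.iterate_succ_apply]

theorem coeff_iterate_pderiv {n : ℕ} (i : Fin n) (k : ℕ) (d : Fin n →₀ ℕ)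
    (p : MvPolynomial (Fin n) ℂ) :
    coeff d ((fun r => pderiv i r)^[k] p) =
      (d i + 1).ascFactorial k * coeff (d + Finsupp.single i k) p := by
  induction k generalizing p with
  | zero => simp
  | succ k ih =>
    rw [Function.iterate_succ_apply, ih, coeff_pderiv, Nat.ascFactorial_succ, add_assoc,
      ← Finsupp.single_add]
    simp
    ring

theorem coeff_foldl_pderiv {n : ℕ} (e : Fin n → ℕ) (l : List (Fin n)) (hl : l.Nodup)
    (p : MvPolynomial (Fin n) ℂ) :
    coeff 0 (l.foldl (fun q i => (fun r => pderiv i r)^[e i] q) p) =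
      (l.map fun i => ((e i).factorial : ℂ)).prod *
        coeff (l.map fun i => Finsupp.single i (e i)).sum p := by
  induction l generalizing p with
  | nil => simp
  | cons i l ih =>
    have hi : (l.map fun i => Finsupp.single i (e i)).sum i = 0 := by
      rw [← Finsupp.applyAddHom_apply, map_list_sum, List.map_map]
      refine List.sum_eq_zero fun x hx => ?_
      obtain ⟨j, hj, rfl⟩ := List.mem_map.1 hx
      have : j ≠ i := fun h => (List.nodup_cons.1 hl).1 (h ▸ hj)
      simp [this]
    rw [List.foldl_cons, ih (List.nodup_cons.1 hl).2, coeff_iterate_pderiv, hi]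
    simp only [zero_add, Nat.one_ascFactorial, List.map_cons, List.prod_cons, List.sum_cons]
    rw [add_comm (Finsupp.single i (e i))]
    ring

theorem eval_pderivs {n : ℕ} (x : ℂ) (e : Fin n → ℕ) (p : MvPolynomial (Fin n) ℂ) :
    eval (fun _ => x) (pderivs e p) =
      (∏ i, ((e i).factorial : ℂ)) * exponentCoeff (translate x p) e := by
  rw [eval_const_eq_coeff_translate, translate_pderivs, pderivs,
    coeff_foldl_pderiv e _ (List.nodup_finRange n), ← List.ofFn_eq_map, ← List.ofFn_eq_map,
    List.prod_ofFn, List.sum_ofFn, exponentCoeff]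
  congr
  ext i
  simp [Finsupp.single_apply]

/-! ### Antisymmetric coefficient functions -/

/-- Antisymmetry of a function of exponent vectors under permutations of the entries. -/
def IsAntisymm {n : ℕ} (c : (Fin n → ℕ) → ℂ) : Prop :=
  ∀ (σ : Equiv.Perm (Fin n)) (e : Fin n → ℕ), c (e ∘ σ) = ((Equiv.Perm.sign σ : ℤ) : ℂ) * c e

theorem IsAntisymm.eq_zero {n : ℕ} {c : (Fin n → ℕ) → ℂ} (hc : IsAntisymm c) {e : Fin n → ℕ}
    {i j : Fin n} (hij : i ≠ j) (h : e i = e j) : c e = 0 := by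
  have h1 := hc (Equiv.swap i j) e
  have h2 : e ∘ Equiv.swap i j = e := by
    funext k
    simp only [Function.comp_apply, Equiv.swap_apply_def]
    split_ifs <;> simp_all
  rw [h2, Equiv.Perm.sign_swap hij] at h1
  simp only [Units.val_neg, Units.val_one, Int.cast_neg, Int.cast_one, neg_mul, one_mul] at h1
  exact self_eq_neg.1 h1

theorem isAntisymm_exponentCoeff {n : ℕ} {f : MvPolynomial (Fin n) ℂ}
    (hf : ∀ σ : Equiv.Perm (Fin n), rename σ f = (Equiv.Perm.sign σ : ℤ) • f) :
    IsAntisymm (exponentCoeff f) := by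
  intro σ e
  have h := coeff_rename_mapDomain σ σ.injective f (Finsupp.equivFunOnFinite.symm (e ∘ σ))
  have h2 : (Finsupp.equivFunOnFinite.symm (e ∘ σ)).mapDomain σ =
      Finsupp.equivFunOnFinite.symm e := by
    ext i
    obtain ⟨k, rfl⟩ := σ.surjective i
    rw [Finsupp.mapDomain_apply σ.injective]
    simp
  rw [h2, hf] at h
  rw [exponentCoeff, ← h, exponentCoeff, ← zsmul_eq_mul, coeff_smul]

theorem IsAntisymm.snoc_eq_cons {n : ℕ} {c : (Fin (n + 1) → ℕ) → ℂ} (hc : IsAntisymm c)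
    (a : ℕ) (e : Fin n → ℕ) :
    c (Fin.snoc (α := fun _ => ℕ) e a) = (-1) ^ n * c (Fin.cons (α := fun _ => ℕ) a e) := by
  have h := hc (finRotate (n + 1)) (Fin.cons (α := fun _ => ℕ) a e)
  rw [sign_finRotate] at h
  rw [Fin.snoc_eq_cons_rotate]
  simpa [Function.comp_def] using h

/-- The sum of `c` over all ways to increase one entry of the exponent vector by one. -/
noncomputable def raise {n : ℕ} (c : (Fin n → ℕ) → ℂ) (e : Fin n → ℕ) : ℂ :=
  ∑ j, c (e + Pi.single j 1)

theorem IsAntisymm.raise {n : ℕ} {c : (Fin n → ℕ) → ℂ} (hc : IsAntisymm c) :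
    IsAntisymm (raise c) := by
  intro σ e
  rw [AntisymDeriv.raise, AntisymDeriv.raise, Finset.mul_sum]
  refine Eq.trans ?_ (Equiv.sum_comp σ _)
  refine Finset.sum_congr rfl fun j _ => ?_
  rw [← hc]
  congr 1
  funext i
  simp [Pi.single_apply]

theorem IsAntisymm.snoc_zero {n : ℕ} {c : (Fin (n + 1) → ℕ) → ℂ} (hc : IsAntisymm c) :
    IsAntisymm fun e : Fin n → ℕ => c (Fin.snoc (α := fun _ => ℕ) (e + 1) 0) := by
  intro σ e
  have h := hc (Equiv.Perm.viaFintypeEmbedding σ Fin.castSuccEmb)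
    (Fin.snoc (α := fun _ => ℕ) (e + 1) 0)
  rw [Equiv.Perm.viaFintypeEmbedding_sign] at h
  rw [← h]
  refine congrArg c (funext fun i => ?_)
  refine Fin.lastCases ?_ (fun i => ?_) i
  · rw [Function.comp_apply, Equiv.Perm.viaFintypeEmbedding_apply_notMem_range]
    · simp
    · simp
  · have := Equiv.Perm.viaFintypeEmbedding_apply_image σ
      (Fin.castSuccEmb (n := n)) i
    simp only [Fin.coe_castSuccEmb] at this
    rw [Function.comp_apply, this]
    simp

/-! ### Expansion in the first variable -/

theorem finSuccEquiv_vandermonde (n : ℕ) :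
    finSuccEquiv ℂ n (vandermonde (n + 1)) =
      (∏ j, (Polynomial.X - Polynomial.C (X j))) * Polynomial.C (vandermonde n) := by
  simp only [vandermonde, map_prod, Finset.prod_filter, Fintype.prod_prod_type,
    Fin.prod_univ_succ (n := n)]
  simp [← Finset.prod_filter, finSuccEquiv_X_zero, finSuccEquiv_X_succ, apply_ite]

theorem coeff_zero_prod_X_sub_C {n : ℕ} (s : Finset (Fin n)) :
    (∏ j ∈ s, (Polynomial.X - Polynomial.C (X j : MvPolynomial (Fin n) ℂ))).coeff 0 =
      (-1) ^ s.card * ∏ j ∈ s, X j := by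
  rw [Polynomial.coeff_zero_prod, ← Finset.prod_neg]
  simp

theorem coeff_one_prod_X_sub_C {n : ℕ} :
    (∏ j, (Polynomial.X - Polynomial.C (X j : MvPolynomial (Fin n) ℂ))).coeff 1 =
      -((-1) ^ n * ∑ j, ∏ i ∈ univ.erase j, X i) := by
  have h := Polynomial.coeff_derivative
    (∏ j, (Polynomial.X - Polynomial.C (X j : MvPolynomial (Fin n) ℂ))) 0
  rw [Polynomial.derivative_prod_finset] at h
  simp only [zero_add, Nat.cast_zero, mul_one] at h
  rw [← h, Polynomial.finsetSum_coeff, Finset.mul_sum, ← Finset.sum_neg_distrib]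
  refine Finset.sum_congr rfl fun j _ => ?_
  have hn : n ≠ 0 := fun h0 => (h0 ▸ j).elim0
  simp only [Polynomial.derivative_sub, Polynomial.derivative_X, Polynomial.derivative_C,
    sub_zero, mul_one]
  rw [coeff_zero_prod_X_sub_C, Finset.card_erase_of_mem (mem_univ j), Finset.card_univ,
    Fintype.card_fin]
  obtain ⟨k, rfl⟩ := Nat.exists_eq_succ_of_ne_zero hn
  simp [pow_succ]

theorem exponentCoeff_prod_X_mul {n : ℕ} (h : MvPolynomial (Fin n) ℂ) (e : Fin n → ℕ) :
    exponentCoeff ((∏ j, X j) * h) (e + 1) = exponentCoeff h e := by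
  have h1 : (∏ j, X j : MvPolynomial (Fin n) ℂ) =
      monomial (Finsupp.equivFunOnFinite.symm 1) 1 := by
    rw [monomial_eq]
    simp [Finsupp.prod_fintype]
  have h2 : (Finsupp.equivFunOnFinite.symm (e + 1) : Fin n →₀ ℕ) =
      Finsupp.equivFunOnFinite.symm 1 + Finsupp.equivFunOnFinite.symm e := by
    ext i
    simp [add_comm]
  rw [exponentCoeff, h1, h2, coeff_monomial_mul, one_mul, exponentCoeff]

theorem exponentCoeff_prod_erase_X_mul {n : ℕ} (h : MvPolynomial (Fin n) ℂ) (e : Fin n → ℕ)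
    (j : Fin n) :
    exponentCoeff ((∏ i ∈ univ.erase j, X i) * h) (e + 1) =
      exponentCoeff h (e + Pi.single j 1) := by
  rw [← exponentCoeff_prod_X_mul h, ← Finset.mul_prod_erase univ _ (mem_univ j), mul_assoc]
  have : (Finsupp.equivFunOnFinite.symm (e + Pi.single j 1 + 1) : Fin n →₀ ℕ) =
      Finsupp.single j 1 + Finsupp.equivFunOnFinite.symm (e + 1) := by
    ext i
    simp [Finsupp.single_apply, Pi.single_apply, eq_comm]
    ring
  rw [exponentCoeff, exponentCoeff, this, coeff_X_mul]

theorem exponentCoeff_coeff_finSuccEquiv {n : ℕ} (f : MvPolynomial (Fin (n + 1)) ℂ) (k : ℕ)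
    (e : Fin n → ℕ) :
    exponentCoeff ((finSuccEquiv ℂ n f).coeff k) e =
      exponentCoeff f (Fin.cons (α := fun _ => ℕ) k e) := by
  rw [exponentCoeff, finSuccEquiv_coeff_coeff, exponentCoeff]
  congr 1

theorem exponentCoeff_vandermonde_mul_coeff_zero {n : ℕ} {f g : MvPolynomial (Fin (n + 1)) ℂ}
    (hf : IsAntisymm (exponentCoeff f)) (hfg : f = vandermonde (n + 1) * g) (e : Fin n → ℕ) :
    exponentCoeff (vandermonde n * (finSuccEquiv ℂ n g).coeff 0) e =
      exponentCoeff f (Fin.snoc (α := fun _ => ℕ) (e + 1) 0) := by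
  rw [hf.snoc_eq_cons, ← exponentCoeff_coeff_finSuccEquiv, hfg, map_mul,
    finSuccEquiv_vandermonde, mul_assoc, Polynomial.mul_coeff_zero, Polynomial.coeff_C_mul,
    coeff_zero_prod_X_sub_C, mul_assoc, Finset.card_univ, Fintype.card_fin,
    ← exponentCoeff_prod_X_mul (vandermonde n * _)]
  have : ((-1) ^ n : MvPolynomial (Fin n) ℂ) = C ((-1) ^ n) := by simp
  rw [this, exponentCoeff, exponentCoeff, coeff_C_mul, ← mul_assoc ((-1 : ℂ) ^ n),
    ← mul_pow]
  simp

theorem exponentCoeff_vandermonde_mul_coeff_one {n : ℕ} {f g : MvPolynomial (Fin (n + 1)) ℂ}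
    (hf : IsAntisymm (exponentCoeff f)) (hfg : f = vandermonde (n + 1) * g) (e : Fin n → ℕ) :
    exponentCoeff (vandermonde n * (finSuccEquiv ℂ n g).coeff 1) e =
      raise (exponentCoeff f) (Fin.snoc (α := fun _ => ℕ) (e + 1) 0) := by
  have hlast : (Fin.snoc (α := fun _ => ℕ) (e + 1) 0 + Pi.single (Fin.last n) 1 : _ → ℕ) =
      Fin.snoc (α := fun _ => ℕ) (e + 1) 1 := by
    funext i
    refine Fin.lastCases ?_ (fun i => ?_) i <;> simp [(Fin.castSucc_lt_last _).ne]
  have hcast : ∀ j : Fin n,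
      (Fin.snoc (α := fun _ => ℕ) (e + 1) 0 + Pi.single j.castSucc 1 : _ → ℕ) =
        Fin.snoc (α := fun _ => ℕ) (e + Pi.single j 1 + 1) 0 := by
    intro j
    funext i
    refine Fin.lastCases ?_ (fun i => ?_) i
    · simp [(Fin.castSucc_lt_last _).ne']
    · simp [Pi.single_apply, add_right_comm]
  have hC : ((-1) ^ n : MvPolynomial (Fin n) ℂ) = C ((-1) ^ n) := by simp
  have hsq : ((-1) ^ n * (-1) ^ n : ℂ) = 1 := by rw [← mul_pow]; simp
  rw [raise, Fin.sum_univ_castSucc, hlast]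
  simp only [hcast, ← exponentCoeff_vandermonde_mul_coeff_zero hf hfg]
  rw [hf.snoc_eq_cons, ← exponentCoeff_coeff_finSuccEquiv, hfg, map_mul,
    finSuccEquiv_vandermonde, mul_assoc, Polynomial.mul_coeff_one, Polynomial.coeff_C_mul,
    Polynomial.coeff_C_mul, coeff_zero_prod_X_sub_C, coeff_one_prod_X_sub_C, Finset.card_univ,
    Fintype.card_fin, hC]
  simp only [exponentCoeff, neg_mul, mul_assoc, coeff_add, coeff_neg, coeff_C_mul, Finset.sum_mul,
    coeff_sum]
  simp only [← exponentCoeff.eq_1, exponentCoeff_prod_X_mul, exponentCoeff_prod_erase_X_mul]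
  rw [mul_add, mul_neg, ← mul_assoc, ← mul_assoc, hsq]
  ring

/-! ### The branching rule for standard Young tableaux -/

/-- `T` is a standard filling of the diagram with row lengths `l` by the elements of `Fin N`. -/
def IsTableau {n N : ℕ} (l : Fin n → ℕ) (T : (Σ i : Fin n, Fin (l i)) → Fin N) : Prop :=
  Function.Bijective T ∧
    (∀ i : Fin n, StrictMono fun j : Fin (l i) => T ⟨i, j⟩) ∧
    (∀ (i i' : Fin n) (j : Fin (l i)) (j' : Fin (l i')),
      i < i' → (j : ℕ) = (j' : ℕ) → T ⟨i, j⟩ < T ⟨i', j'⟩)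

/-- Extend a filling to a larger diagram, with the new largest value on all new cells. -/
def extendFilling {n N : ℕ} (l l' : Fin n → ℕ) (T : (Σ i : Fin n, Fin (l' i)) → Fin N)
    (c : Σ i : Fin n, Fin (l i)) : Fin (N + 1) :=
  if h : (c.2 : ℕ) < l' c.1 then (T ⟨c.1, c.2, h⟩).castSucc else Fin.last N

theorem extendFilling_of_lt {n N : ℕ} {l l' : Fin n → ℕ}
    (T : (Σ i : Fin n, Fin (l' i)) → Fin N) {i : Fin n} {x : Fin (l i)} (h : (x : ℕ) < l' i) :
    extendFilling l l' T ⟨i, x⟩ = (T ⟨i, x, h⟩).castSucc :=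
  dif_pos h

theorem extendFilling_of_le {n N : ℕ} {l l' : Fin n → ℕ}
    (T : (Σ i : Fin n, Fin (l' i)) → Fin N) {i : Fin n} {x : Fin (l i)} (h : l' i ≤ (x : ℕ)) :
    extendFilling l l' T ⟨i, x⟩ = Fin.last N :=
  dif_neg (not_lt.2 h)

theorem IsTableau.le_of_eq_last {n N : ℕ} {l : Fin n → ℕ}
    {T : (Σ i : Fin n, Fin (l i)) → Fin (N + 1)} (hT : IsTableau l T) {j : Fin n}
    {x : Fin (l j)} (hx : T ⟨j, x⟩ = Fin.last N) : l j = x + 1 := by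
  by_contra h
  have h1 : (x : ℕ) + 1 < l j := by have := x.2; omega
  have h2 : T ⟨j, x⟩ < T ⟨j, ⟨x + 1, h1⟩⟩ := hT.2.1 j (Fin.lt_def.2 (by simp))
  rw [hx] at h2
  exact absurd h2 (not_lt.2 (Fin.le_last _))

theorem IsTableau.row_le_of_eq_last {n N : ℕ} {l : Fin n → ℕ}
    {T : (Σ i : Fin n, Fin (l i)) → Fin (N + 1)} (hT : IsTableau l T) {j i : Fin n}
    {x : Fin (l j)} (hx : T ⟨j, x⟩ = Fin.last N) (hij : j < i) : l i ≤ x := by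
  by_contra! h
  have h2 := hT.2.2 j i x ⟨x, h⟩ hij rfl
  rw [hx] at h2
  exact absurd h2 (not_lt.2 (Fin.le_last _))

theorem le_add_single {n : ℕ} (l : Fin n → ℕ) (j i : Fin n) : l i ≤ (l + Pi.single j 1 : Fin n → ℕ) i := by
  simp

theorem eq_of_le_of_lt_add_single {n : ℕ} {l : Fin n → ℕ} {j i : Fin n} {x : ℕ}
    (h1 : l i ≤ x) (h2 : x < (l + Pi.single j 1 : Fin n → ℕ) i) : i = j ∧ x = l j := by
  rcases eq_or_ne i j with rfl | h
  · simp at h2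
    exact ⟨rfl, by omega⟩
  · simp [h] at h2
    omega

theorem isTableau_extendFilling {n N : ℕ} {l : Fin n → ℕ} {j : Fin n}
    (hl : Antitone l) {T : (Σ i : Fin n, Fin (l i)) → Fin N}
    (hT : IsTableau l T) : IsTableau (l + Pi.single j 1) (extendFilling _ l T) := by
  refine ⟨⟨?_, ?_⟩, ?_, ?_⟩
  · rintro ⟨i, x⟩ ⟨i', x'⟩ h
    rcases lt_or_ge (x : ℕ) (l i) with hx | hx <;> rcases lt_or_ge (x' : ℕ) (l i') with hx' | hx'
    · rw [extendFilling_of_lt T hx, extendFilling_of_lt T hx'] at h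
      have := hT.1.1 (Fin.castSucc_injective _ h)
      simp only [Sigma.mk.injEq] at this
      obtain ⟨rfl, h2⟩ := this
      have h3 := congrArg Fin.val (eq_of_heq h2)
      simp only at h3
      rw [Fin.ext h3]
    · rw [extendFilling_of_lt T hx, extendFilling_of_le T hx'] at h
      exact absurd h (Fin.castSucc_ne_last _)
    · rw [extendFilling_of_le T hx, extendFilling_of_lt T hx'] at h
      exact absurd h.symm (Fin.castSucc_ne_last _)
    · obtain ⟨hi, h1⟩ := eq_of_le_of_lt_add_single hx x.2
      obtain ⟨hi', h2⟩ := eq_of_le_of_lt_add_single hx' x'.2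
      subst hi hi'
      rw [Fin.ext (h1.trans h2.symm)]
  · intro y
    refine Fin.lastCases ?_ (fun y => ?_) y
    · exact ⟨⟨j, l j, by simp⟩, extendFilling_of_le T le_rfl⟩
    · obtain ⟨⟨i, x⟩, rfl⟩ := hT.1.2 y
      exact ⟨⟨i, x, x.2.trans_le (le_add_single l j i)⟩, extendFilling_of_lt T x.2⟩
  · intro i x x' h
    dsimp only
    have hx : (x : ℕ) < l i := by
      by_contra! hx
      have h1 := (eq_of_le_of_lt_add_single hx x.2)
      have h2 := (eq_of_le_of_lt_add_single (hx.trans h.le) x'.2)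
      have := Fin.lt_def.1 h
      omega
    rw [extendFilling_of_lt T hx]
    rcases lt_or_ge (x' : ℕ) (l i) with hx' | hx'
    · rw [extendFilling_of_lt T hx']
      exact Fin.castSucc_lt_castSucc_iff.2 (hT.2.1 i (Fin.lt_def.2 h))
    · rw [extendFilling_of_le T hx']
      exact Fin.castSucc_lt_last _
  · intro i i' x x' hi h
    have hx : (x : ℕ) < l i := by
      by_contra! hx
      have h1 := eq_of_le_of_lt_add_single hx x.2
      have h4 : l i' ≤ x' := by
        rw [← h, h1.2, ← h1.1]
        exact hl hi.le
      have h5 := eq_of_le_of_lt_add_single h4 x'.2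
      exact hi.ne (h1.1.trans h5.1.symm)
    rw [extendFilling_of_lt T hx]
    rcases lt_or_ge (x' : ℕ) (l i') with hx' | hx'
    · rw [extendFilling_of_lt T hx']
      exact Fin.castSucc_lt_castSucc_iff.2 (hT.2.2 i i' _ _ hi h)
    · rw [extendFilling_of_le T hx']
      exact Fin.castSucc_lt_last _

theorem exists_extendFilling {n N : ℕ} {l : Fin n → ℕ} {j : Fin n}
    {T : (Σ i : Fin n, Fin ((l + Pi.single j 1 : Fin n → ℕ) i)) → Fin (N + 1)}
    (hT : IsTableau (l + Pi.single j 1) T) (hlast : ∃ x, T ⟨j, x⟩ = Fin.last N) :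
    ∃ T' : (Σ i : Fin n, Fin (l i)) → Fin N, IsTableau l T' ∧ extendFilling _ l T' = T := by
  obtain ⟨x₀, hx₀⟩ := hlast
  have hx₀' : (x₀ : ℕ) = l j := by
    have := hT.le_of_eq_last hx₀
    simp at this
    omega
  have hne : ∀ (i : Fin n) (x : Fin (l i)),
      T ⟨i, x, x.2.trans_le (le_add_single l j i)⟩ ≠ Fin.last N := by
    intro i x h
    have h1 := hT.1.1 (h.trans hx₀.symm)
    simp only [Sigma.mk.injEq] at h1
    obtain ⟨rfl, h2⟩ := h1
    have h3 := congrArg Fin.val (eq_of_heq h2)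
    have := x.2
    simp only at h3
    omega
  have hext : extendFilling _ l
      (fun c => (T ⟨c.1, c.2, c.2.2.trans_le (le_add_single l j c.1)⟩).castPred (hne c.1 c.2)) =
      T := by
    funext ⟨i, x⟩
    rcases lt_or_ge (x : ℕ) (l i) with hx | hx
    · rw [extendFilling_of_lt _ hx]
      simp
    · rw [extendFilling_of_le _ hx, ← hx₀]
      obtain ⟨hi, h1⟩ := eq_of_le_of_lt_add_single hx x.2
      subst hi
      rw [Fin.ext (h1.trans hx₀'.symm)]
  refine ⟨_, ⟨⟨?_, ?_⟩, ?_, ?_⟩, hext⟩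
  · rintro ⟨i, x⟩ ⟨i', x'⟩ h
    have h1 := hT.1.1 (Fin.castPred_inj.1 h)
    simp only [Sigma.mk.injEq] at h1
    obtain ⟨rfl, h2⟩ := h1
    have h3 := congrArg Fin.val (eq_of_heq h2)
    simp only at h3
    rw [Fin.ext h3]
  · intro y
    obtain ⟨⟨i, x⟩, hy⟩ := hT.1.2 y.castSucc
    have hx : (x : ℕ) < l i := by
      by_contra! hx
      rw [← hext, extendFilling_of_le _ hx] at hy
      exact Fin.castSucc_ne_last _ hy.symm
    refine ⟨⟨i, x, hx⟩, Fin.castSucc_injective _ ?_⟩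
    simpa using hy
  · intro i x x' h
    exact Fin.castPred_lt_castPred_iff.2 (hT.2.1 i (Fin.lt_def.2 h))
  · intro i i' x x' hi h
    exact Fin.castPred_lt_castPred_iff.2 (hT.2.2 i i' _ _ hi h)

theorem extendFilling_injective {n N : ℕ} (l : Fin n → ℕ) (j : Fin n) :
    Function.Injective (extendFilling (N := N) (l + Pi.single j 1) l) := by
  intro T T' h
  funext ⟨i, x⟩
  have h1 := congrFun h ⟨i, x, x.2.trans_le (le_add_single l j i)⟩
  rw [extendFilling_of_lt T (by exact x.2), extendFilling_of_lt T' (by exact x.2)] at h1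
  exact Fin.castSucc_injective _ h1

theorem card_tableau_last_mem_row {n N : ℕ} {l : Fin n → ℕ} (hl : Antitone l) (j : Fin n) :
    Nat.card {T : (Σ i : Fin n, Fin ((l + Pi.single j 1 : Fin n → ℕ) i)) → Fin (N + 1) //
      IsTableau (l + Pi.single j 1) T ∧ ∃ x, T ⟨j, x⟩ = Fin.last N} =
    Nat.card {T : (Σ i : Fin n, Fin (l i)) → Fin N // IsTableau l T} := by
  refine (Nat.card_congr (Equiv.ofBijective (fun T => ⟨extendFilling _ l T.1,
    isTableau_extendFilling hl T.2, ⟨l j, by simp⟩, extendFilling_of_le T.1 le_rfl⟩)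
    ⟨fun T T' h => ?_, fun T => ?_⟩)).symm
  · exact Subtype.ext (extendFilling_injective l j (congrArg Subtype.val h))
  · obtain ⟨T', h1, h2⟩ := exists_extendFilling T.2.1 T.2.2
    exact ⟨⟨T', h1⟩, Subtype.ext h2⟩

open Classical in
/-- The partitions of `m`, padded with zeros to `n` parts. -/
noncomputable def paddedPartitions (n m : ℕ) : Finset (Fin n → ℕ) :=
  (Finset.piAntidiag univ m).filter Antitone

theorem mem_paddedPartitions {n m : ℕ} {l : Fin n → ℕ} :
    l ∈ paddedPartitions n m ↔ ∑ i, l i = m ∧ Antitone l := by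
  simp [paddedPartitions]

theorem sytCard_eq {n m : ℕ} {l : Fin n → ℕ} (h : ∑ i, l i = m) :
    sytCard l = Nat.card {T : (Σ i : Fin n, Fin (l i)) → Fin m // IsTableau l T} := by
  subst h
  rfl

theorem sum_add_single {n : ℕ} (l : Fin n → ℕ) (j : Fin n) :
    ∑ i, (l + Pi.single j 1 : Fin n → ℕ) i = ∑ i, l i + 1 := by
  simp [Finset.sum_add_distrib]

open Classical in
theorem card_tableau_last_mem_row_eq_sum {n m : ℕ} {l : Fin n → ℕ} (hl : Antitone l)
    (hm : ∑ i, l i = m + 1) (j : Fin n) :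
    Nat.card {T : (Σ i : Fin n, Fin (l i)) → Fin (m + 1) //
      IsTableau l T ∧ ∃ x, T ⟨j, x⟩ = Fin.last m} =
    ∑ l' ∈ paddedPartitions n m, if l' + Pi.single j 1 = l then sytCard l' else 0 := by
  by_cases h : ∃ l' ∈ paddedPartitions n m, l' + Pi.single j 1 = l
  · obtain ⟨l', hl', rfl⟩ := h
    rw [Finset.sum_eq_single l' _ (fun h => absurd hl' h), if_pos rfl,
      card_tableau_last_mem_row (mem_paddedPartitions.1 hl').2,
      sytCard_eq (mem_paddedPartitions.1 hl').1]
    intro l'' _ hne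
    rw [if_neg fun h => hne (add_right_cancel h)]
  · rw [Finset.sum_eq_zero fun l' hl' => if_neg fun h' => h ⟨l', hl', h'⟩, Nat.card_eq_zero]
    refine Or.inl ⟨fun ⟨T, hT, x, hx⟩ => h ?_⟩
    have hj := hT.le_of_eq_last hx
    have hadd : l - Pi.single j 1 + Pi.single j 1 = l := by
      refine tsub_add_cancel_of_le fun i => ?_
      rcases eq_or_ne i j with rfl | hij
      · simp; omega
      · simp [hij]
    refine ⟨l - Pi.single j 1, mem_paddedPartitions.2 ⟨?_, ?_⟩, hadd⟩
    · have := sum_add_single (l - Pi.single j 1) j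
      rw [hadd] at this
      omega
    · intro i k hik
      have h1 := hl hik
      rcases eq_or_ne i j with rfl | hij
      · rcases eq_or_ne k i with rfl | hk
        · rfl
        · have h2 := hT.row_le_of_eq_last hx (lt_of_le_of_ne hik hk.symm)
          simp [hk]
          omega
      · rcases eq_or_ne k j with rfl | hk
        · simp [hij]
          omega
        · simpa [hij, hk] using h1

open Classical in
theorem sytCard_eq_sum {n m : ℕ} {l : Fin n → ℕ} (hl : l ∈ paddedPartitions n (m + 1)) :
    sytCard l = ∑ j, ∑ l' ∈ paddedPartitions n m,
      if l' + Pi.single j 1 = l then sytCard l' else 0 := by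
  rw [mem_paddedPartitions] at hl
  simp only [← card_tableau_last_mem_row_eq_sum hl.2 hl.1]
  rw [sytCard_eq hl.1, ← Nat.card_sigma]
  refine (Nat.card_congr (Equiv.ofBijective (fun T => ⟨T.2.1, T.2.2.1⟩) ⟨?_, ?_⟩)).symm
  · rintro ⟨j, T, hT, x, hx⟩ ⟨j', T', hT', x', hx'⟩ h
    obtain rfl : T = T' := congrArg Subtype.val h
    have h1 := hT.1.1 (hx.trans hx'.symm)
    simp only [Sigma.mk.injEq] at h1
    obtain ⟨rfl, -⟩ := h1
    rfl
  · rintro ⟨T, hT⟩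
    obtain ⟨⟨j, x⟩, hx⟩ := hT.1.2 (Fin.last m)
    exact ⟨⟨j, T, hT, x, hx⟩, rfl⟩

theorem sytCard_castSucc {n : ℕ} (l : Fin (n + 1) → ℕ) (h : l (Fin.last n) = 0) :
    sytCard (fun i : Fin n => l i.castSucc) = sytCard l := by
  have hsum : ∑ i, l i = ∑ i : Fin n, l i.castSucc := by
    rw [Fin.sum_univ_castSucc, h, add_zero]
  rw [sytCard_eq rfl, sytCard_eq hsum]
  have : IsEmpty (Fin (l (Fin.last n))) := by rw [h]; infer_instance
  let φ : (Σ i : Fin n, Fin (l i.castSucc)) ≃ Σ i : Fin (n + 1), Fin (l i) :=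
    Equiv.ofBijective (fun c => ⟨c.1.castSucc, c.2⟩) ⟨by
      rintro ⟨i, x⟩ ⟨i', x'⟩ h
      simp only [Sigma.mk.injEq, Fin.castSucc_inj] at h
      obtain ⟨rfl, h⟩ := h
      rw [eq_of_heq h], by
      rintro ⟨i, x⟩
      refine Fin.lastCases (fun x => isEmptyElim x) (fun i x => ⟨⟨i, x⟩, rfl⟩) i x⟩
  refine (Nat.card_congr (Equiv.subtypeEquiv (Equiv.arrowCongr φ.symm (Equiv.refl _))
    fun T => ?_)).symm
  change _ ↔ IsTableau _ (T ∘ φ)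
  refine and_congr (Function.Bijective.of_comp_iff T φ.bijective).symm (and_congr ?_ ?_)
  · refine ⟨fun H i => H i.castSucc, fun H i => ?_⟩
    exact Fin.lastCases (motive := fun i => StrictMono fun j : Fin (l i) => T ⟨i, j⟩)
      (fun x => isEmptyElim x) H i
  · refine ⟨fun H i i' x x' hi => H _ _ x x' (Fin.castSucc_lt_castSucc_iff.2 hi),
      fun H i i' => ?_⟩
    induction i using Fin.lastCases with
    | last => exact fun x => isEmptyElim x
    | cast i =>
      induction i' using Fin.lastCases with
      | last => exact fun _ x => isEmptyElim x
      | cast i' => exact fun x x' hi => H i i' x x' (Fin.castSucc_lt_castSucc_iff.1 hi)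

/-! ### Sums over partitions weighted by the number of tableaux -/

/-- The staircase `(n - 1, n - 2, …, 0)`. -/
def staircase (n : ℕ) (i : Fin n) : ℕ := n - 1 - i

/-- The sum of `f_λ * c (λ + δ)` over partitions `λ` of `m`, where `δ` is the staircase. -/
noncomputable def tableauSum (n m : ℕ) (c : (Fin n → ℕ) → ℂ) : ℂ :=
  ∑ l ∈ paddedPartitions n m, (sytCard l : ℂ) * c (l + staircase n)

theorem IsAntisymm.eq_zero_of_not_antitone {n : ℕ} {c : (Fin n → ℕ) → ℂ} (hc : IsAntisymm c)
    {l : Fin n → ℕ} (hl : Antitone l) {j : Fin n} (h : ¬ Antitone (l + Pi.single j 1)) :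
    c (l + Pi.single j 1 + staircase n) = 0 := by
  obtain ⟨k, hk⟩ : ∃ k : Fin n, (k : ℕ) + 1 = j ∧ l k = l j := by
    obtain ⟨n, rfl⟩ : ∃ n', n = n' + 1 := ⟨n - 1, by have := j.2; omega⟩
    rw [Fin.antitone_iff_succ_le] at h
    push Not at h
    obtain ⟨i, hi⟩ := h
    have h1 := hl (Fin.castSucc_lt_succ (i := i)).le
    rcases eq_or_ne i.succ j with rfl | hij
    · refine ⟨i.castSucc, by simp, ?_⟩
      simp at hi
      omega
    · simp [hij] at hi
      omega
  refine hc.eq_zero (i := k) (j := j) (fun hkj => ?_) ?_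
  · subst hkj
    omega
  · have hkj : k ≠ j := fun hkj => by subst hkj; omega
    have := j.2
    simp [staircase, hkj]
    omega

theorem tableauSum_succ {n m : ℕ} {c : (Fin n → ℕ) → ℂ} (hc : IsAntisymm c) :
    tableauSum n (m + 1) c = tableauSum n m (raise c) := by
  classical
  have h1 : tableauSum n (m + 1) c = ∑ l ∈ paddedPartitions n (m + 1),
      ∑ j, ∑ l' ∈ paddedPartitions n m,
        if l' + Pi.single j 1 = l then (sytCard l' : ℂ) * c (l + staircase n) else 0 := by
    refine Finset.sum_congr rfl fun l hl => ?_
    rw [sytCard_eq_sum hl]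
    push_cast
    simp only [Finset.sum_mul, ite_mul, zero_mul]
  have h2 : ∀ l' ∈ paddedPartitions n m, ∀ j,
      (∑ l ∈ paddedPartitions n (m + 1),
        if l' + Pi.single j 1 = l then (sytCard l' : ℂ) * c (l + staircase n) else 0) =
      (sytCard l' : ℂ) * c (l' + staircase n + Pi.single j 1) := by
    intro l' hl' j
    rw [mem_paddedPartitions] at hl'
    rw [Finset.sum_ite_eq, add_right_comm l' (staircase n)]
    split_ifs with h
    · rfl
    · rw [hc.eq_zero_of_not_antitone hl'.2, mul_zero]
      refine fun hanti => h (mem_paddedPartitions.2 ⟨?_, hanti⟩)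
      rw [sum_add_single, hl'.1]
  rw [h1, Finset.sum_comm]
  simp only [Finset.sum_comm (s := paddedPartitions n (m + 1))]
  rw [Finset.sum_comm, tableauSum]
  refine Finset.sum_congr rfl fun l' hl' => ?_
  rw [raise, Finset.mul_sum]
  exact Finset.sum_congr rfl fun j _ => h2 l' hl' j

theorem last_eq_zero_of_mem_paddedPartitions {n m : ℕ} (hm : m ≤ n) {l : Fin (n + 1) → ℕ}
    (hl : l ∈ paddedPartitions (n + 1) m) : l (Fin.last n) = 0 := by
  rw [mem_paddedPartitions] at hl
  by_contra h
  have h1 : ∑ _i : Fin (n + 1), 1 ≤ ∑ i, l i :=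
    Finset.sum_le_sum fun i _ => (Nat.one_le_iff_ne_zero.2 h).trans (hl.2 (Fin.le_last i))
  simp at h1
  omega

theorem tableauSum_snoc {n m : ℕ} (hm : m ≤ n) (c : (Fin (n + 1) → ℕ) → ℂ) :
    tableauSum (n + 1) m c =
      tableauSum n m fun e => c (Fin.snoc (α := fun _ => ℕ) (e + 1) 0) := by
  refine Finset.sum_nbij' (fun l i => l i.castSucc) (fun l => Fin.snoc (α := fun _ => ℕ) l 0)
    ?_ ?_ ?_ ?_ ?_
  · intro l hl
    have h0 := last_eq_zero_of_mem_paddedPartitions hm hl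
    rw [mem_paddedPartitions] at hl ⊢
    refine ⟨?_, fun i j hij => hl.2 (Fin.castSucc_le_castSucc_iff.2 hij)⟩
    rw [← hl.1, Fin.sum_univ_castSucc, h0, add_zero]
  · intro l hl
    rw [mem_paddedPartitions] at hl ⊢
    refine ⟨by simpa [Fin.sum_univ_castSucc] using hl.1, fun i j hij => ?_⟩
    induction j using Fin.lastCases with
    | last => simp
    | cast j =>
      induction i using Fin.lastCases with
      | last => exact absurd (hij.trans_lt (Fin.castSucc_lt_last j)) (lt_irrefl _)
      | cast i => simpa using hl.2 (Fin.castSucc_le_castSucc_iff.1 hij)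
  · intro l hl
    have h0 := last_eq_zero_of_mem_paddedPartitions hm hl
    funext i
    refine Fin.lastCases ?_ (fun i => ?_) i <;> simp [h0]
  · intro l _
    funext i
    simp
  · intro l hl
    have h0 := last_eq_zero_of_mem_paddedPartitions hm hl
    rw [sytCard_castSucc l h0]
    congr 2
    funext i
    refine Fin.lastCases ?_ (fun i => ?_) i
    · simp [h0, staircase]
    · simp [staircase]
      omega

theorem tableauSum_zero_zero (c : (Fin 0 → ℕ) → ℂ) : tableauSum 0 0 c = c 0 := by
  have h0 : paddedPartitions 0 0 = {0} := by
    ext l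
    rw [mem_paddedPartitions, mem_singleton]
    exact ⟨fun _ => Subsingleton.elim _ _, fun _ => ⟨by simp, fun i => i.elim0⟩⟩
  have h1 : sytCard (0 : Fin 0 → ℕ) = 1 := by
    rw [sytCard_eq (m := 0) (by simp), Nat.card_eq_one_iff_unique]
    refine ⟨⟨fun T T' => Subtype.ext (Subsingleton.elim _ _)⟩, ⟨⟨fun c => c.1.elim0, ?_⟩⟩⟩
    exact ⟨⟨fun c => c.1.elim0, fun y => y.elim0⟩, fun i => i.elim0, fun i => i.elim0⟩
  rw [tableauSum, h0, Finset.sum_singleton, h1, Nat.cast_one, one_mul]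
  congr 1
  exact Subsingleton.elim _ _

/-! ### The coefficient formula -/

theorem exponentCoeff_quotient (n m : ℕ) (hm : m ≤ n) (f g : MvPolynomial (Fin n) ℂ)
    (hf : IsAntisymm (exponentCoeff f)) (hfg : f = vandermonde n * g) :
    exponentCoeff g (fun i => if (i : ℕ) < m then 1 else 0) =
      tableauSum n m (exponentCoeff f) := by
  induction n generalizing m with
  | zero =>
    obtain rfl : m = 0 := by omega
    rw [tableauSum_zero_zero, hfg]
    simp only [vandermonde, Finset.univ_eq_empty, Finset.filter_empty, Finset.prod_empty, one_mul]
    congr 1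
  | succ n ih =>
    cases m with
    | zero =>
      have h0 : exponentCoeff (vandermonde n * (finSuccEquiv ℂ n g).coeff 0) = _ :=
        funext fun e => exponentCoeff_vandermonde_mul_coeff_zero hf hfg e
      have h := ih 0 (Nat.zero_le n) _ _ (by rw [h0]; exact hf.snoc_zero) rfl
      rw [h0, ← tableauSum_snoc (Nat.zero_le n), exponentCoeff_coeff_finSuccEquiv] at h
      rw [← h]
      congr 1
      funext i
      refine Fin.cases ?_ (fun i => ?_) i <;> simp
    | succ m =>
      have h1 : exponentCoeff (vandermonde n * (finSuccEquiv ℂ n g).coeff 1) = _ :=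
        funext fun e => exponentCoeff_vandermonde_mul_coeff_one hf hfg e
      have h := ih m (by omega) _ _ (by rw [h1]; exact hf.raise.snoc_zero) rfl
      rw [h1, ← tableauSum_snoc (by omega), ← tableauSum_succ hf,
        exponentCoeff_coeff_finSuccEquiv] at h
      rw [← h]
      congr 1
      funext i
      refine Fin.cases ?_ (fun i => ?_) i <;> simp

theorem sum_YsPad {n m : ℕ} (F : (Fin n → ℕ) → ℂ) :
    ∑ l ∈ YsPad n m, F (fun i => (l i : ℕ)) = ∑ l ∈ paddedPartitions n m, F l := by
  refine Finset.sum_bij (fun l _ i => (l i : ℕ)) ?_ ?_ ?_ fun _ _ => rfl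
  · intro l hl
    obtain ⟨-, h1, h2⟩ := mem_filter.1 hl
    exact mem_paddedPartitions.2 ⟨h2, h1⟩
  · intro l _ l' _ h
    funext i
    exact Fin.ext (congrFun h i)
  · intro l hl
    obtain ⟨h1, h2⟩ := mem_paddedPartitions.1 hl
    have hlt : ∀ i, l i < m + 1 := fun i => by
      rw [← h1]
      exact Nat.lt_succ_of_le (Finset.single_le_sum (fun _ _ => Nat.zero_le _) (mem_univ i))
    exact ⟨fun i => ⟨l i, hlt i⟩, mem_filter.2 ⟨mem_univ _, h2, h1⟩, rfl⟩

theorem antisymmetric_quotient_derivative_formula (n m : ℕ) (hn : 1 ≤ n) (hm : m ≤ n)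
    (f : MvPolynomial (Fin n) ℂ)
    (hf : ∀ σ : Equiv.Perm (Fin n),
      MvPolynomial.rename σ f = (Equiv.Perm.sign σ : ℤ) • f) :
    vandermonde n ∣ f ∧
    ∀ g : MvPolynomial (Fin n) ℂ, f = vandermonde n * g → ∀ x : ℂ,
      MvPolynomial.eval (fun _ => x)
          (pderivs (fun i => if (i : ℕ) < m then 1 else 0) g) =
        ∑ l ∈ YsPad n m,
          ((sytCard fun i => (l i : ℕ)) : ℂ) /
            ((∏ i : Fin n, Nat.factorial ((l i : ℕ) + (n - 1 - (i : ℕ)))) : ℂ) *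
          MvPolynomial.eval (fun _ => x)
            (pderivs (fun i => (l i : ℕ) + (n - 1 - (i : ℕ))) f) := by
  refine ⟨vandermonde_dvd hf, fun g hfg x => ?_⟩
  have hanti : IsAntisymm (exponentCoeff (translate x f)) :=
    isAntisymm_exponentCoeff fun σ => by rw [rename_translate, hf, map_zsmul]
  have hquot : translate x f = vandermonde n * translate x g := by
    rw [hfg, map_mul, translate_vandermonde]
  have hfact : ∏ i : Fin n, ((if (i : ℕ) < m then 1 else 0 : ℕ).factorial : ℂ) = 1 :=
    Finset.prod_eq_one fun i _ => by split_ifs <;> simp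
  rw [sum_YsPad fun l => (sytCard l : ℂ) /
    ((∏ i : Fin n, Nat.factorial (l i + (n - 1 - (i : ℕ)))) : ℂ) *
      eval (fun _ => x) (pderivs (fun i => l i + (n - 1 - (i : ℕ))) f),
    eval_pderivs, hfact, one_mul, exponentCoeff_quotient n m hm _ _ hanti hquot, tableauSum]
  refine Finset.sum_congr rfl fun l _ => ?_
  rw [eval_pderivs, ← mul_assoc, div_mul_cancel₀]
  · rfl
  · exact Finset.prod_ne_zero_iff.2 fun i _ => Nat.cast_ne_zero.2 (Nat.factorial_ne_zero _)

end AntisymDeriv
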